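/- Let m ≥ 4 and n ≥ 5. There is no strategyproof SDS that is α-Condorcet-consistent and β-ex post efficient with β < ((m−2)/(m−1))·α. -/

import Mathlib

open Finset

noncomputable section

/-- A preference profile: each voter's strict linear order on the `m`
alternatives is encoded as a ranking permutation, where `R i x` is the rank of
alternative `x` for voter `i` (rank `0` = most preferred). Voter `i` strictly
prefers `x` to `y` iff `R i x < R i y`. -/
abbrev Profile (n m : ℕ) := Fin n → Equiv.Perm (Fin m)

/-- `F R x` is the probability that the social decision scheme `F` assigns to
alternative `x` at profile `R`; `IsSDS F` says every `F R` is a lottery. -/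
def IsSDS {n m : ℕ} (F : Profile n m → Fin m → ℝ) : Prop :=
  (∀ R x, 0 ≤ F R x) ∧ ∀ R, ∑ x, F R x = 1

/-- Stochastic-dominance preference of voter `i` (with preferences as in `R`):
lottery `p` is weakly preferred to lottery `q`. -/
def SDPref {n m : ℕ} (R : Profile n m) (i : Fin n) (p q : Fin m → ℝ) : Prop :=
  ∀ x : Fin m,
    ∑ y ∈ univ.filter (fun y => R i y < R i x), q y ≤
      ∑ y ∈ univ.filter (fun y => R i y < R i x), p y

/-- Strategyproofness: the truthful outcome is SD-preferred to any outcome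
obtainable by a unilateral deviation. -/
def Strategyproof {n m : ℕ} (F : Profile n m → Fin m → ℝ) : Prop :=
  ∀ (R R' : Profile n m) (i : Fin n),
    (∀ j, j ≠ i → R j = R' j) → SDPref R i (F R) (F R')

/-- Anonymity: permuting the voters does not change the outcome. -/
def Anonymous {n m : ℕ} (F : Profile n m → Fin m → ℝ) : Prop :=
  ∀ (π : Equiv.Perm (Fin n)) (R : Profile n m), F (fun i => R (π i)) = F R

/-- The profile obtained from `R` by relabeling the alternatives by `τ`
(in `relabel τ R`, alternative `τ x` gets the rank that `x` has in `R`). -/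
def relabel {n m : ℕ} (τ : Equiv.Perm (Fin m)) (R : Profile n m) : Profile n m :=
  fun i => τ.symm.trans (R i)

/-- Neutrality: relabeling the alternatives permutes the outcome accordingly. -/
def Neutral {n m : ℕ} (F : Profile n m → Fin m → ℝ) : Prop :=
  ∀ (τ : Equiv.Perm (Fin m)) (R : Profile n m) (x : Fin m),
    F (relabel τ R) (τ x) = F R x

/-- The supporting size `n_{xy}(R)`: the number of voters preferring `x` to `y`. -/
def suppSize {n m : ℕ} (R : Profile n m) (x y : Fin m) : ℕ :=
  (univ.filter (fun i => R i x < R i y)).card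

/-- `x` is the Condorcet winner of `R`. -/
def CondorcetWinner {n m : ℕ} (R : Profile n m) (x : Fin m) : Prop :=
  ∀ y, y ≠ x → suppSize R y x < suppSize R x y

/-- `α`-Condorcet-consistency. -/
def CondorcetConsistent {n m : ℕ} (F : Profile n m → Fin m → ℝ) (α : ℝ) : Prop :=
  ∀ R x, CondorcetWinner R x → α ≤ F R x

/-- `x` is Pareto-dominated in `R`. -/
def ParetoDominated {n m : ℕ} (R : Profile n m) (x : Fin m) : Prop :=
  ∃ y, ∀ i, R i y < R i x

/-- `β`-ex post efficiency. -/
def ExPostEff {n m : ℕ} (F : Profile n m → Fin m → ℝ) (β : ℝ) : Prop :=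
  ∀ R x, ParetoDominated R x → F R x ≤ β

/-- The probability that the dictatorial SDS of voter `i` assigns to `x`:
`1` if `x` is voter `i`'s most preferred alternative and `0` otherwise. -/
def dictProb {n m : ℕ} (R : Profile n m) (i : Fin n) (x : Fin m) : ℝ :=
  if ∀ y, R i x ≤ R i y then 1 else 0

/-- `d` is a random dictatorship. -/
def IsRandDict {n m : ℕ} (d : Profile n m → Fin m → ℝ) : Prop :=
  ∃ δ : Fin n → ℝ, (∀ i, 0 ≤ δ i) ∧ ∑ i, δ i = 1 ∧
    ∀ R x, d R x = ∑ i, δ i * dictProb R i x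

/-- `F` can be written as `γ d + (1 - γ) g` with `d` a random dictatorship and
`g` a strategyproof SDS. -/
def DecomposesAt {n m : ℕ} (F : Profile n m → Fin m → ℝ) (γ : ℝ) : Prop :=
  ∃ d g : Profile n m → Fin m → ℝ, IsRandDict d ∧ IsSDS g ∧ Strategyproof g ∧
    ∀ R x, F R x = γ * d R x + (1 - γ) * g R x

/-- `F` is `γ`-randomly dictatorial: `γ ∈ [0,1]` is the maximal value admitting
a decomposition `F = γ d + (1 - γ) g` as above. -/
def RandDictDegree {n m : ℕ} (F : Profile n m → Fin m → ℝ) (γ : ℝ) : Prop :=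
  0 ≤ γ ∧ γ ≤ 1 ∧ DecomposesAt F γ ∧
    ∀ γ', 0 ≤ γ' → γ' ≤ 1 → DecomposesAt F γ' → γ' ≤ γ

/-- The profile `R^{i:yx}` obtained from `R` by swapping `x` and `y` in voter
`i`'s preference relation (used when `x` is ranked directly above `y`). -/
def swapTop {n m : ℕ} (R : Profile n m) (i : Fin n) (x y : Fin m) : Profile n m :=
  Function.update R i ((R i).trans (Equiv.swap (R i x) (R i y)))

/-- The weight vector `b` defining the randomized Copeland rule:
`b k = 2/(m(m-1))` for `k > n/2`, `b k = 1/(m(m-1))` for `k = n/2`, `b k = 0`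
for `k < n/2`. -/
def copelandWeight (n m : ℕ) (k : ℕ) : ℝ :=
  if n < 2 * k then 2 / ((m : ℝ) * ((m : ℝ) - 1))
  else if 2 * k = n then 1 / ((m : ℝ) * ((m : ℝ) - 1))
  else 0

/-- The randomized Copeland rule `f_C(R, x) = ∑_{y ≠ x} b_{n_{xy}(R)}`. -/
def randCopeland (n m : ℕ) : Profile n m → Fin m → ℝ :=
  fun R x => ∑ y ∈ univ.filter (fun y => y ≠ x), copelandWeight n m (suppSize R x y)

/-- A point voting SDS, given by a scoring vector `a` (indexed by ranks
`0, …, m-1`, i.e. `a k` is the score of the `(k+1)`-st ranked alternative). -/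
structure PointVoting (n m : ℕ) where
  a : ℕ → ℝ
  mono : ∀ k l : ℕ, k ≤ l → l < m → a l ≤ a k
  nonneg : ∀ k : ℕ, k < m → 0 ≤ a k
  sum_eq : ∑ k ∈ Finset.range m, a k = 1 / (n : ℝ)

/-- The value of a point voting SDS. -/
def pvVal {n m : ℕ} (pv : PointVoting n m) : Profile n m → Fin m → ℝ :=
  fun R x => ∑ i, pv.a (R i x : ℕ)

/-- A supporting size SDS, given by a vector `b` indexed by supporting sizes
`0, …, n`. -/
structure SupportingSize (n m : ℕ) where
  b : ℕ → ℝ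
  mono : ∀ k l : ℕ, k ≤ l → l ≤ n → b k ≤ b l
  nonneg : ∀ k : ℕ, k ≤ n → 0 ≤ b k
  pair_eq : ∀ k : ℕ, k ≤ n → b k + b (n - k) = 2 / ((m : ℝ) * ((m : ℝ) - 1))

/-- The value of a supporting size SDS. -/
def ssVal {n m : ℕ} (S : SupportingSize n m) : Profile n m → Fin m → ℝ :=
  fun R x => ∑ y ∈ univ.filter (fun y => y ≠ x), S.b (suppSize R x y)

/-- A duple: a strategyproof SDS that puts positive probability on at most two
fixed alternatives. -/
def IsDuple {n m : ℕ} (g : Profile n m → Fin m → ℝ) : Prop :=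
  IsSDS g ∧ Strategyproof g ∧ ∃ x y : Fin m, ∀ R z, z ≠ x → z ≠ y → g R z = 0

/-- A unilateral: a strategyproof SDS that depends only on the preferences of a
single fixed voter. -/
def IsUnilateral {n m : ℕ} (g : Profile n m → Fin m → ℝ) : Prop :=
  IsSDS g ∧ Strategyproof g ∧
    ∃ i : Fin n, ∀ R R' : Profile n m, R i = R' i → g R = g R'

/-- `F` is a convex combination of SDSs satisfying the property `P`. -/
def MixOf {n m : ℕ} (P : (Profile n m → Fin m → ℝ) → Prop)
    (F : Profile n m → Fin m → ℝ) : Prop :=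
  ∃ (K : ℕ) (w : Fin K → ℝ) (g : Fin K → Profile n m → Fin m → ℝ),
    (∀ k, 0 ≤ w k) ∧ ∑ k, w k = 1 ∧ (∀ k, P (g k)) ∧
    ∀ R x, F R x = ∑ k, w k * g k R x

/-- The uniform random dictatorship. -/
def uniformRD (n m : ℕ) : Profile n m → Fin m → ℝ :=
  fun R x => (1 / (n : ℝ)) * ∑ i, dictProb R i x

/-- The uniform lottery. -/
def uniformLottery (n m : ℕ) : Profile n m → Fin m → ℝ :=
  fun _ _ => 1 / (m : ℝ)

section Aux

variable {n m : ℕ}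

/-- Upper contour set. -/
def Up (p : Equiv.Perm (Fin m)) (x : Fin m) : Finset (Fin m) :=
  univ.filter (fun y => p y < p x)

theorem exists_perm_key (key : Fin m → ℕ) :
    ∃ p : Equiv.Perm (Fin m), ∀ a b, key a < key b → p a < p b := by
  refine ⟨(Tuple.sort key)⁻¹, fun a b h => ?_⟩
  by_contra hc
  push Not at hc
  have := Tuple.monotone_sort key hc
  simp at this
  omega

theorem Up_of_key {key : Fin m → ℕ} {p : Equiv.Perm (Fin m)}
    (hp : ∀ a b, key a < key b → p a < p b) {x : Fin m} {A : Finset (Fin m)}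
    (hx : x ∉ A) (h1 : ∀ a ∈ A, key a < key x) (h2 : ∀ a, a ∉ A → a ≠ x → key x < key a) :
    Up p x = A := by
  ext a
  simp only [Up, mem_filter, mem_univ, true_and]
  constructor
  · intro h
    by_contra ha
    have hax : a ≠ x := by rintro rfl; exact lt_irrefl _ h
    exact absurd (hp _ _ (h2 a ha hax)) (not_lt.mpr h.le)
  · intro h
    exact hp _ _ (h1 a h)

theorem sp_closed {F : Profile n m → Fin m → ℝ} (hF : IsSDS F) (hS : Strategyproof F)
    (R R' : Profile n m) (i : Fin n) (h : ∀ j, j ≠ i → R j = R' j) (x : Fin m) :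
    ∑ y ∈ insert x (Up (R i) x), F R' y ≤ ∑ y ∈ insert x (Up (R i) x), F R y := by
  by_cases hl : ∃ w, (R i w : ℕ) = R i x + 1
  · obtain ⟨w, hw⟩ := hl
    have := hS R R' i h w
    have e : univ.filter (fun y => R i y < R i w) = insert x (Up (R i) x) := by
      ext a
      simp only [Up, mem_filter, mem_univ, true_and, mem_insert, Fin.lt_def, hw]
      constructor
      · intro h
        by_cases hh : (R i a : ℕ) = R i x
        · left; exact (R i).injective (Fin.ext hh)
        · right; omega
      · rintro (rfl | h) <;> omega
    rwa [e] at this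
  · have e : insert x (Up (R i) x) = univ := by
      ext a
      simp only [Up, mem_filter, mem_univ, true_and, mem_insert, iff_true, Fin.lt_def]
      by_contra hc
      push Not at hc
      obtain ⟨hc1, hc2⟩ := hc
      have h3 : (R i a : ℕ) ≠ R i x := fun hh => hc1 ((R i).injective (Fin.ext hh))
      have h4 := (R i a).isLt
      apply hl
      refine ⟨(R i).symm ⟨R i x + 1, by omega⟩, by simp⟩
    rw [e, hF.2, hF.2]

theorem sp_open {F : Profile n m → Fin m → ℝ} (hS : Strategyproof F)
    (R R' : Profile n m) (i : Fin n) (h : ∀ j, j ≠ i → R j = R' j) (x : Fin m) :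
    ∑ y ∈ Up (R i) x, F R' y ≤ ∑ y ∈ Up (R i) x, F R y := hS R R' i h x

theorem not_mem_Up (p : Equiv.Perm (Fin m)) (x : Fin m) : x ∉ Up p x := by
  simp [Up]

theorem local1 {F : Profile n m → Fin m → ℝ} (hF : IsSDS F) (hS : Strategyproof F)
    (R R' : Profile n m) (i : Fin n) (h : ∀ j, j ≠ i → R j = R' j) (x : Fin m)
    (hu : Up (R i) x = Up (R' i) x) : F R x = F R' x := by
  have h' : ∀ j, j ≠ i → R' j = R j := fun j hj => (h j hj).symm
  have a1 := sp_closed hF hS R R' i h x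
  have a2 := sp_closed hF hS R' R i h' x
  have a3 := sp_open hS R R' i h x
  have a4 := sp_open hS R' R i h' x
  rw [sum_insert (not_mem_Up _ _), sum_insert (not_mem_Up _ _)] at a1 a2
  rw [← hu] at a2 a4
  linarith

theorem localAll {F : Profile n m → Fin m → ℝ} (hF : IsSDS F) (hS : Strategyproof F)
    (R R' : Profile n m) (x : Fin m)
    (hu : ∀ j, Up (R j) x = Up (R' j) x) : F R x = F R' x := by
  have key : ∀ s : Finset (Fin n), F (s.piecewise R' R) x = F R x := by
    intro s
    induction s using Finset.induction_on with
    | empty => simp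
    | insert i s hi ih =>
      rw [← ih]
      apply local1 hF hS _ _ i
      · intro j hj
        simp [Finset.piecewise, hj]
      · simp [Finset.piecewise, hi, hu i]
  have := key univ
  simp at this
  exact this.symm

/-- Voter `i` swaps adjacent `x`, `z`. -/
theorem swap_adj {F : Profile n m → Fin m → ℝ} (hF : IsSDS F) (hS : Strategyproof F)
    (R R' : Profile n m) (i : Fin n) (h : ∀ j, j ≠ i → R j = R' j) (x z : Fin m)
    (W : Finset (Fin m)) (hxz : z ≠ x) (hx : x ∉ W) (hz : z ∉ W)
    (h1 : Up (R i) x = W) (h2 : Up (R i) z = insert x W)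
    (h3 : Up (R' i) z = W) (h4 : Up (R' i) x = insert z W) :
    F R' x ≤ F R x ∧ F R x + F R z = F R' x + F R' z := by
  have h' : ∀ j, j ≠ i → R' j = R j := fun j hj => (h j hj).symm
  have a1 := sp_closed hF hS R R' i h z
  have a2 := sp_closed hF hS R' R i h' x
  have a3 := sp_open hS R R' i h x
  have a4 := sp_open hS R' R i h' z
  have a5 := sp_open hS R R' i h z
  have n1 : z ∉ insert x W := by simp [hxz, hz]
  have n2 : x ∉ insert z W := by simp [hxz.symm, hx]
  rw [h2, sum_insert n1, sum_insert n1, sum_insert hx, sum_insert hx] at a1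
  rw [h4, sum_insert n2, sum_insert n2, sum_insert hz, sum_insert hz] at a2
  rw [h1] at a3
  rw [h3] at a4
  rw [h2, sum_insert hx, sum_insert hx] at a5
  constructor <;> linarith

/-- Canonical ranking with upper contour set `A` (minus `x`) at `x`. -/
def rkKey (x : Fin m) (A : Finset (Fin m)) (a : Fin m) : ℕ :=
  if a = x then 1 else if a ∈ A then 0 else 2

def rk (x : Fin m) (A : Finset (Fin m)) : Equiv.Perm (Fin m) :=
  Classical.choose (exists_perm_key (rkKey x A))

theorem rk_spec (x : Fin m) (A : Finset (Fin m)) (a b : Fin m)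
    (h : rkKey x A a < rkKey x A b) : rk x A a < rk x A b :=
  Classical.choose_spec (exists_perm_key (rkKey x A)) a b h

theorem Up_rk (x : Fin m) (A : Finset (Fin m)) : Up (rk x A) x = A.erase x := by
  apply Up_of_key (rk_spec x A)
  · simp
  · intro a ha
    simp at ha
    simp [rkKey, ha]
  · intro a ha hax
    simp [hax] at ha
    simp [rkKey, ha, hax]

def phi (F : Profile n m → Fin m → ℝ) (x : Fin m) (U : Fin n → Finset (Fin m)) : ℝ :=
  F (fun j => rk x (U j)) x

theorem phi_eq {F : Profile n m → Fin m → ℝ} (hF : IsSDS F) (hS : Strategyproof F)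
    (x : Fin m) (R : Profile n m) (U : Fin n → Finset (Fin m))
    (h : ∀ j, Up (R j) x = (U j).erase x) : F R x = phi F x U := by
  apply localAll hF hS
  intro j
  rw [h, Up_rk]

theorem exists_sep (x z : Fin m) (hxz : z ≠ x) (A : Finset (Fin m)) :
    ∃ p : Equiv.Perm (Fin m), Up p x = A.erase x ∧
      Up p z = if z ∈ A then ∅ else univ.erase z := by
  by_cases hz : z ∈ A
  · obtain ⟨p, hp⟩ := exists_perm_key (fun a => if a = z then 0 else rkKey x A a + 1)
    refine ⟨p, ?_, ?_⟩
    · apply Up_of_key hp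
      · simp
      · intro a ha
        simp at ha
        by_cases haz : a = z <;> simp [rkKey, ha, haz, hxz.symm]
      · intro a ha hax
        simp [hax] at ha
        have : a ≠ z := by rintro rfl; exact ha hz
        simp [rkKey, ha, hax, this, hxz.symm]
    · rw [if_pos hz]
      apply Up_of_key hp
      · simp
      · simp
      · intro a _ ha
        simp [ha]
  · obtain ⟨p, hp⟩ := exists_perm_key (fun a => if a = z then 3 else rkKey x A a)
    refine ⟨p, ?_, ?_⟩
    · apply Up_of_key hp
      · simp
      · intro a ha
        simp at ha
        have : a ≠ z := by rintro rfl; exact hz ha.2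
        simp [rkKey, ha, this, hxz.symm]
      · intro a ha hax
        simp [hax] at ha
        by_cases haz : a = z <;> simp [rkKey, ha, haz, hxz.symm, hax]
    · rw [if_neg hz]
      apply Up_of_key hp
      · simp
      · intro a ha
        simp at ha
        simp only [ha, if_false, if_true, rkKey]
        split_ifs <;> omega
      · intro a ha hax
        simp [hax] at ha

theorem exists_adj (x z : Fin m) (hxz : z ≠ x) (W : Finset (Fin m)) (hx : x ∉ W) (hz : z ∉ W) :
    ∃ p : Equiv.Perm (Fin m), Up p x = W ∧ Up p z = insert x W := by
  obtain ⟨p, hp⟩ := exists_perm_key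
    (fun a => if a ∈ W then 0 else if a = x then 1 else if a = z then 2 else 3)
  refine ⟨p, ?_, ?_⟩
  · apply Up_of_key hp hx
    · intro a ha; simp [ha, hx]
    · intro a ha hax
      simp only [ha, hax, hx, if_false, if_true]
      split_ifs <;> omega
  · apply Up_of_key hp
    · simp [hxz, hz]
    · intro a ha
      simp only [hz, hxz, if_false, if_true]
      simp only [mem_insert] at ha
      rcases ha with rfl | ha
      · simp [hx]
      · simp [ha]
    · intro a ha haz
      simp only [mem_insert, not_or] at ha
      simp [ha, haz, hz, hxz]

/-- The transfer from `x` when voter `i`, having `W` above `x`, moves `z` above `x`. -/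
def tr {A : Type*} [DecidableEq A] (φ : (Fin n → Finset A) → ℝ) (i : Fin n) (z : A) (W : Finset A)
    (U : Fin n → Finset A) : ℝ :=
  φ (Function.update U i W) - φ (Function.update U i (insert z W))

theorem tr_rep {F : Profile n m → Fin m → ℝ} (hF : IsSDS F) (hS : Strategyproof F)
    (x z : Fin m) (hxz : z ≠ x) (i : Fin n) (W : Finset (Fin m)) (hx : x ∉ W) (hz : z ∉ W) :
    ∀ U V : Fin n → Finset (Fin m), (∀ j, j ≠ i → (z ∈ U j ↔ z ∈ V j)) →
      0 ≤ tr (phi F x) i z W U ∧ tr (phi F x) i z W U = tr (phi F x) i z W V := by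
  obtain ⟨p, hp1, hp2⟩ := exists_adj x z hxz W hx hz
  obtain ⟨q, hq1, hq2⟩ := exists_adj z x hxz.symm W hz hx
  choose s hs1 hs2 using fun A => exists_sep x z hxz A
  have main : ∀ U : Fin n → Finset (Fin m),
      0 ≤ tr (phi F x) i z W U ∧ tr (phi F x) i z W U =
        F (Function.update (fun j => s (U j)) i q) z
          - F (Function.update (fun j => s (U j)) i p) z := by
    intro U
    have e1 : F (Function.update (fun j => s (U j)) i p) x = phi F x (Function.update U i W) := by
      apply phi_eq hF hS
      intro j
      by_cases hj : j = i
      · subst hj; simp [hp1, hx]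
      · simp [hj, hs1]
    have e2 : F (Function.update (fun j => s (U j)) i q) x
        = phi F x (Function.update U i (insert z W)) := by
      apply phi_eq hF hS
      intro j
      by_cases hj : j = i
      · subst hj
        have : x ∉ insert z W := by simp [hxz.symm, hx]
        simp [hq2, erase_eq_of_notMem this]
      · simp [hj, hs1]
    have := swap_adj hF hS (Function.update (fun j => s (U j)) i p)
      (Function.update (fun j => s (U j)) i q) i (by intro j hj; simp [hj]) x z W hxz hx hz
      (by simp [hp1]) (by simp [hp2]) (by simp [hq1]) (by simp [hq2])
    rw [e1, e2] at this
    unfold tr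
    constructor <;> linarith [this.1, this.2]
  intro U V hUV
  refine ⟨(main U).1, ?_⟩
  rw [(main U).2, (main V).2]
  have g : ∀ r : Equiv.Perm (Fin m), F (Function.update (fun j => s (U j)) i r) z
      = F (Function.update (fun j => s (V j)) i r) z := by
    intro r
    apply localAll hF hS
    intro j
    by_cases hj : j = i
    · subst hj; simp
    · simp [hj, hs2, hUV j hj]
  rw [g, g]

section Abs

variable {A : Type*} [DecidableEq A] {φ : (Fin n → Finset A) → ℝ} {x : A}

theorem tr_upd (φ : (Fin n → Finset A) → ℝ) (i : Fin n) (z : A) (W W' : Finset A)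
    (U : Fin n → Finset A) : tr φ i z W (Function.update U i W') = tr φ i z W U := by
  simp [tr]

theorem tr_add
    (hind : ∀ z, z ≠ x → ∀ i W, x ∉ W → z ∉ W → ∀ U V : Fin n → Finset A,
      (∀ j, j ≠ i → (z ∈ U j ↔ z ∈ V j)) → tr φ i z W U = tr φ i z W V)
    (i : Fin n) (z : A) (hz : z ≠ x) (U V : Fin n → Finset A) (W : Finset A) :
    x ∉ W → z ∉ W →
    tr φ i z W U - tr φ i z ∅ U = tr φ i z W V - tr φ i z ∅ V := by
  induction W using Finset.induction_on with
  | empty => intros; simp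
  | insert y W hy ih =>
    intro hx' hz'
    simp only [mem_insert, not_or] at hx' hz'
    have ih := ih hx'.2 hz'.2
    -- intermediate family
    let M : Fin n → Finset A := fun j =>
      (if z ∈ U j then {z} else ∅) ∪ (if y ∈ V j then {y} else ∅)
    have hMz : ∀ j, j ≠ i → (z ∈ U j ↔ z ∈ M j) := by
      intro j _
      have := hz'.1
      by_cases h1 : z ∈ U j <;> by_cases h2 : y ∈ V j <;> simp [M, h1, h2, this]
    have hMy : ∀ j, j ≠ i → (y ∈ M j ↔ y ∈ V j) := by
      intro j _
      have := Ne.symm hz'.1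
      by_cases h1 : z ∈ U j <;> by_cases h2 : y ∈ V j <;> simp [M, h1, h2, this]
    have hyx : y ≠ x := Ne.symm hx'.1
    have a1 := hind z hz i W hx'.2 hz'.2 U M hMz
    have a2 := hind z hz i (insert y W) (by simp [hx']) (by simp [hz']) U M hMz
    have b1 := hind y hyx i W hx'.2 hy M V hMy
    have b2 := hind y hyx i (insert z W) (by simp [hx', hz.symm])
      (by simp [hy, Ne.symm hz'.1]) M V hMy
    simp only [tr] at *
    rw [Finset.insert_comm y z] at b2
    linarith

theorem tele (ψ : ℕ → ℝ) : ∑ i : Fin n, (ψ i - ψ (i + 1)) = ψ 0 - ψ n := by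
  rw [Fin.sum_univ_eq_sum_range (fun k => ψ k - ψ (k + 1)), Finset.sum_range_sub']

theorem abs_main [Fintype A]
    (hind : ∀ z, z ≠ x → ∀ i W, x ∉ W → z ∉ W → ∀ U V : Fin n → Finset A,
      (∀ j, j ≠ i → (z ∈ U j ↔ z ∈ V j)) → tr φ i z W U = tr φ i z W V)
    (hpos : ∀ z, z ≠ x → ∀ i W, x ∉ W → z ∉ W → ∀ U : Fin n → Finset A, 0 ≤ tr φ i z W U) :
    ∃ (B : A → ℝ) (κ : Fin n → A → ℝ),
      (∀ z, z ≠ x → ∀ W, x ∉ W → z ∉ W → B z ≤ φ (fun _ => W) - φ (fun _ => insert z W)) ∧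
      (∀ (k : ℕ) (y : A) (c : Fin n → A), y ≠ x → (∀ j, c j ≠ x) → (∀ j, c j = y ↔ (j : ℕ) < k) →
        φ (fun j => {c j}) - φ (fun _ => {y}) ≤ B y + ∑ i, (κ i y - κ i (c i))) := by
  have hmin : ∀ (i : Fin n) (z : A), ∃ W : Finset A, (x ∉ W ∧ z ∉ W) ∧
      ∀ W', x ∉ W' → z ∉ W' → tr φ i z W (fun _ => ∅) ≤ tr φ i z W' (fun _ => ∅) := by
    intro i z
    obtain ⟨W, hW, h⟩ := Finset.exists_min_image
      ((univ : Finset (Finset A)).filter (fun W => x ∉ W ∧ z ∉ W))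
      (fun W => tr φ i z W (fun _ => ∅)) ⟨∅, by simp⟩
    simp only [mem_filter, mem_univ, true_and] at hW h
    exact ⟨W, hW, fun W' h1 h2 => h W' ⟨h1, h2⟩⟩
  choose Ws hWs hWmin using hmin
  have hW : ∀ i z, z ≠ x → ∀ W', x ∉ W' → z ∉ W' → ∀ U, tr φ i z (Ws i z) U ≤ tr φ i z W' U := by
    intro i z hz W' h1 h2 U
    have e1 := tr_add hind i z hz U (fun _ => ∅) W' h1 h2
    have e2 := tr_add hind i z hz U (fun _ => ∅) (Ws i z) (hWs i z).1 (hWs i z).2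
    have := hWmin i z W' h1 h2
    linarith
  let κ : Fin n → A → ℝ := fun i z => tr φ i z ∅ (fun _ => ∅) - tr φ i z (Ws i z) (fun _ => ∅)
  have hκ : ∀ i z, z ≠ x → ∀ U, tr φ i z ∅ U = tr φ i z (Ws i z) U + κ i z := by
    intro i z hz U
    have e2 := tr_add hind i z hz U (fun _ => ∅) (Ws i z) (hWs i z).1 (hWs i z).2
    simp only [κ]
    linarith
  let Uc : A → Fin n → Fin n → Finset A := fun z i j => if j < i then {z} else ∅
  let b : Fin n → A → ℝ := fun i z => tr φ i z (Ws i z) (Uc z i)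
  refine ⟨fun z => ∑ i, b i z, κ, ?_, ?_⟩
  · intro z hz W hx hzW
    let g : ℕ → Fin n → Finset A := fun k j => if (j : ℕ) < k then insert z W else W
    have e0 : g 0 = fun _ => W := by funext j; simp [g]
    have en : g n = fun _ => insert z W := by funext j; simp [g]
    rw [← e0, ← en, ← tele (n := n) (fun k => φ (g k))]
    apply Finset.sum_le_sum
    intro i _
    have s1 : Function.update (g i) i W = g i := by
      funext j
      by_cases hj : j = i
      · subst hj; simp [g]
      · simp [hj]
    have s2 : Function.update (g i) i (insert z W) = g (i + 1) := by
      funext j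
      by_cases hj : j = i
      · subst hj; simp [g]
      · have hj' : (j : ℕ) ≠ i := fun h => hj (Fin.ext h)
        have : (j : ℕ) < i ↔ (j : ℕ) < i + 1 := by omega
        simp only [g, Function.update_of_ne hj, this]
    have s3 : φ (g i) - φ (g (i + 1)) = tr φ i z W (g i) := by
      rw [tr, s1, s2]
    rw [s3, hind z hz i W hx hzW (g i) (Uc z i)]
    · exact hW i z hz W hx hzW _
    · intro j hj
      by_cases h : j < i
      · have h' : (j : ℕ) < i := h
        simp [g, Uc, h]
      · have h' : ¬ (j : ℕ) < i := h
        simp [g, Uc, h, hzW]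
  · intro k y c hy hc hk
    let g : ℕ → Fin n → Finset A := fun k j => if (j : ℕ) < k then {y} else {c j}
    have e0 : g 0 = fun j => {c j} := by funext j; simp [g]
    have en : g n = fun _ => {y} := by funext j; simp [g]
    rw [← e0, ← en, ← tele (n := n) (fun k => φ (g k)), ← Finset.sum_add_distrib]
    apply Finset.sum_le_sum
    intro i _
    have s1 : Function.update (g i) i {c i} = g i := by
      funext j
      by_cases hj : j = i
      · subst hj; simp [g]
      · simp [hj]
    have s2 : Function.update (g i) i {y} = g (i + 1) := by
      funext j
      by_cases hj : j = i
      · subst hj; simp [g]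
      · have hj' : (j : ℕ) ≠ i := fun h => hj (Fin.ext h)
        have : (j : ℕ) < i ↔ (j : ℕ) < i + 1 := by omega
        simp only [g, Function.update_of_ne hj, this]
    have s3 : φ (g i) - φ (g (i + 1)) = tr φ i y ∅ (g i) - tr φ i (c i) ∅ (g i) := by
      simp only [tr, insert_empty_eq, s1, s2]
      ring
    by_cases hik : (i : ℕ) < k
    · have hciy := (hk i).2 hik
      rw [hciy] at s3
      have := hpos y hy i _ (hWs i y).1 (hWs i y).2 (Uc y i)
      simp only [b]
      rw [hciy]
      linarith
    · have h1 := hκ i y hy (g i)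
      have h2 := hκ i (c i) (hc i) (g i)
      have h3 := hpos (c i) (hc i) i _ (hWs i (c i)).1 (hWs i (c i)).2 (g i)
      have h4 : tr φ i y (Ws i y) (g i) = tr φ i y (Ws i y) (Uc y i) := by
        apply hind y hy i _ (hWs i y).1 (hWs i y).2
        intro j hj
        by_cases h : j < i
        · have h' : (j : ℕ) < i := h
          simp [g, Uc, h]
        · have h' : ¬ (j : ℕ) < i := h
          have h5 : ¬ c j = y := fun h6 => by have := (hk j).1 h6; omega
          simp [g, Uc, h, Ne.symm h5]
      simp only [b]
      linarith

/-- Chaining the drops. -/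
theorem chain {B : A → ℝ}
    (hB : ∀ z, z ≠ x → ∀ W, x ∉ W → z ∉ W → B z ≤ φ (fun _ => W) - φ (fun _ => insert z W))
    (y : A) (hy : y ≠ x) (Z : Finset A) : x ∉ Z → y ∉ Z →
      ∑ z ∈ Z, B z ≤ φ (fun _ => {y}) - φ (fun _ => insert y Z) := by
  induction Z using Finset.induction_on with
  | empty => intros; simp
  | insert z Z hz ih =>
    intro h1 h2
    simp only [mem_insert, not_or] at h1 h2
    have ih := ih h1.2 h2.2
    have := hB z (Ne.symm h1.1) (insert y Z) (by simp [h1, hy.symm]) (by simp [hz, Ne.symm h2.1])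
    rw [sum_insert hz, Finset.insert_comm y z]
    linarith

end Abs

theorem card_block (n a b : ℕ) (P : Fin n → Prop) [DecidablePred P]
    (h : ∀ j, P j → a ≤ (j : ℕ) ∧ (j : ℕ) < b) : (univ.filter P).card ≤ b - a := by
  rw [← Nat.card_Ico]
  apply Finset.card_le_card_of_injOn (fun j : Fin n => (j : ℕ))
  · intro j hj
    simp at hj
    simpa using h j hj
  · intro a _ b _ h
    exact Fin.ext h

end Aux

/-- For `m ≥ 4` and `n ≥ 5`, there is no strategyproof SDS that is
`α`-Condorcet-consistent and `β`-ex post efficient with `β < (m-2)/(m-1)·α`. -/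
theorem no_alpha_cc_beta_epe (n m : ℕ) (hm : 4 ≤ m) (hn : 5 ≤ n) (α β : ℝ)
    (hβ : β < ((m : ℝ) - 2) / ((m : ℝ) - 1) * α) :
    ¬ ∃ F : Profile n m → Fin m → ℝ,
        IsSDS F ∧ Strategyproof F ∧ CondorcetConsistent F α ∧ ExPostEff F β := by
  rintro ⟨F, hF, hS, hC, hE⟩
  obtain ⟨M, rfl⟩ : ∃ M, m = M + 1 := ⟨m - 1, by omega⟩
  have hM : 3 ≤ M := by omega
  haveI : NeZero M := ⟨by omega⟩
  have hrep := fun z hz i W h1 h2 => tr_rep hF hS (0 : Fin (M + 1)) z hz i W h1 h2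
  obtain ⟨B, κ, hB, hc⟩ := abs_main (φ := phi F 0) (x := (0 : Fin (M + 1)))
    (fun z hz i W h1 h2 U V h => (hrep z hz i W h1 h2 U V h).2)
    (fun z hz i W h1 h2 U => (hrep z hz i W h1 h2 U U (fun _ _ => Iff.rfl)).1)
  have hpar : ∀ y : Fin (M + 1), y ≠ 0 → phi F 0 (fun _ : Fin n => {y}) ≤ β := by
    intro y hy
    apply hE
    refine ⟨y, fun i => ?_⟩
    apply rk_spec
    simp [rkKey, hy]
  -- lower bounds on β
  have hlow : ∀ s : Fin M, ∑ z : Fin M, B z.succ - B s.succ ≤ β := by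
    intro s
    have h0 : (0 : Fin (M + 1)) ∉ ((univ.erase s).map (Fin.succEmb M)) := by
      simp [Fin.succ_ne_zero]
    have h1 : s.succ ∉ ((univ.erase s).map (Fin.succEmb M)) := by simp
    have h := chain hB s.succ (Fin.succ_ne_zero s) _ h0 h1
    rw [Finset.sum_map] at h
    have e := Finset.add_sum_erase univ (fun z : Fin M => B z.succ) (mem_univ s)
    have hp := hpar s.succ (Fin.succ_ne_zero s)
    have hn0 : 0 ≤ phi F 0 (fun _ : Fin n => insert s.succ ((univ.erase s).map (Fin.succEmb M))) :=
      hF.1 _ _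
    simp only [Fin.coe_succEmb] at h
    linarith
  -- upper bounds on α
  let k := (n - 1) / 2
  let d : Fin n → Fin M := fun j =>
    if (j : ℕ) < k then 0 else if (j : ℕ) < 2 * k then ⟨1, by omega⟩ else ⟨2, by omega⟩
  have hd0 : ∀ j, d j = 0 ↔ (j : ℕ) < k := by
    intro j
    simp only [d]
    split_ifs with h1 h2 <;> simp [Fin.ext_iff, h1]
  have hdcard : ∀ v : Fin M, 2 * (univ.filter (fun j => d j = v)).card < n := by
    intro v
    by_cases hv0 : (v : ℕ) = 0
    · have := card_block n 0 k (fun j => d j = v) (by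
        rintro j rfl
        simp only [d] at hv0
        split_ifs at hv0 with h1 h2 <;> first | omega | simp at hv0)
      omega
    · by_cases hv1 : (v : ℕ) = 1
      · have := card_block n k (2 * k) (fun j => d j = v) (by
          rintro j rfl
          simp only [d] at hv1
          split_ifs at hv1 with h1 h2
          · simp at hv1
          · omega
          · simp at hv1)
        omega
      · have := card_block n (2 * k) n (fun j => d j = v) (by
          rintro j rfl
          simp only [d] at hv1 hv0
          split_ifs at hv1 hv0 with h1 h2
          · simp at hv0
          · simp at hv1
          · omega)
        omega
  have hup : ∀ s : Fin M, α - β ≤ B s.succ + ∑ i, (κ i s.succ - κ i (s + d i).succ) := by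
    intro s
    have h := hc k s.succ (fun j => (s + d j).succ) (Fin.succ_ne_zero s)
      (fun j => Fin.succ_ne_zero _) (by
        intro j
        rw [← hd0, Fin.succ_inj]
        simp)
    have hp := hpar s.succ (Fin.succ_ne_zero s)
    have hcw : α ≤ phi F 0 (fun j : Fin n => {(s + d j).succ}) := by
      apply hC
      intro y hy
      obtain ⟨v, rfl⟩ := Fin.exists_succ_eq.2 hy
      have hlt : ∀ j, rk (0 : Fin (M + 1)) {(s + d j).succ} v.succ < rk 0 {(s + d j).succ} 0
          ↔ d j = v - s := by
        intro j
        have hu := Up_rk (0 : Fin (M + 1)) {(s + d j).succ}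
        have : v.succ ∈ Up (rk (0 : Fin (M + 1)) {(s + d j).succ}) 0 ↔ v = s + d j := by
          rw [hu]; simp [Fin.succ_ne_zero]
        simp only [Up, mem_filter, mem_univ, true_and] at this
        rw [this]
        constructor
        · rintro rfl; simp
        · intro h; rw [h]; simp
      have hgt : ∀ j, rk (0 : Fin (M + 1)) {(s + d j).succ} 0 < rk 0 {(s + d j).succ} v.succ
          ↔ ¬ d j = v - s := by
        intro j
        rw [← hlt, not_lt]
        constructor
        · exact le_of_lt
        · intro h
          exact lt_of_le_of_ne h (fun h' => Fin.succ_ne_zero v ((Equiv.injective _ h').symm))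
      unfold suppSize
      simp only [hlt, hgt]
      have h1 := hdcard (v - s)
      have h2 := Finset.card_filter_add_card_filter_not (s := (univ : Finset (Fin n)))
        (fun j => d j = v - s)
      simp at h2
      omega
    linarith
  have hsum1 : (M : ℝ) * (α - β) ≤ ∑ s : Fin M, B s.succ := by
    have h := Finset.sum_le_sum (s := (univ : Finset (Fin M))) (fun s _ => hup s)
    rw [Finset.sum_add_distrib, Finset.sum_comm] at h
    have hz : ∀ i, ∑ s : Fin M, (κ i s.succ - κ i (s + d i).succ) = 0 := by
      intro i
      rw [Finset.sum_sub_distrib,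
        Equiv.sum_comp (Equiv.addRight (d i)) (fun s : Fin M => κ i s.succ) |>.symm]
      simp
    simp only [hz] at h
    simp at h
    linarith
  have hsum2 : (M : ℝ) * (∑ s : Fin M, B s.succ) - ∑ s : Fin M, B s.succ ≤ M * β := by
    have h := Finset.sum_le_sum (s := (univ : Finset (Fin M))) (fun s _ => hlow s)
    rw [Finset.sum_sub_distrib] at h
    simpa using h
  have hMr : (3 : ℝ) ≤ M := by exact_mod_cast hM
  push_cast at hβ
  have e1 : (M : ℝ) + 1 - 2 = M - 1 := by ring
  have e2 : (M : ℝ) + 1 - 1 = M := by ring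
  rw [e1, e2, div_mul_eq_mul_div, lt_div_iff₀ (by linarith)] at hβ
  have h3 : ((M : ℝ) - 1) * (M * (α - β)) ≤ ((M : ℝ) - 1) * ∑ s : Fin M, B s.succ :=
    mul_le_mul_of_nonneg_left hsum1 (by linarith)
  have h4 : (M : ℝ) * (β * M) < M * (((M : ℝ) - 1) * α) :=
    mul_lt_mul_of_pos_left hβ (by linarith)
  nlinarith
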